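/- Let G = (V, E) be a finite simple graph, P ⊆ V a pinned set with |P| ≥ 3, and p : V → ℝ² a generic configuration such that the pinned framework (G, p, P) is isostatic. Then for every edge e = {u₀, v₀} ∈ E there exists a configuration q ≠ p with q(v) = p(v) for all v ∈ P and ‖q(u) − q(v)‖ = ‖p(u) − p(v)‖ for every edge {u, v} ∈ E, such that q is joined to p by a continuous path of configurations along which the pinned vertices stay fixed and the lengths of all edges in E \ {e} are preserved. (This is the guarantee underlying the single-cut algorithm: removing one bar and flexing reaches a second equivalent realization.) -/

import Mathlib

noncomputable section

/-- The Euclidean plane ℝ². -/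
abbrev Plane := EuclideanSpace ℝ (Fin 2)

/-- A configuration `p : V → ℝ^d` is generic if the `d|V|` coordinates of the points
are algebraically independent over ℚ. -/
def IsGenericConfig {V : Type*} (d : ℕ) (p : V → EuclideanSpace ℝ (Fin d)) : Prop :=
  AlgebraicIndependent ℚ (fun vi : V × Fin d => p vi.1 vi.2)

/-- The pinned rigidity matrix of the framework `(G, p)` with pinned set `P`:
one row per edge, two columns per free vertex; the row of an edge `{u, v}` contains
`p u - p v` in the columns of `u` when `u` is free, `p v - p u` in the columns of `v`
when `v` is free, and zeros elsewhere. -/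
def pinnedRigidityMatrix {V : Type*} [DecidableEq V] (G : SimpleGraph V) (P : Set V)
    [DecidablePred (· ∈ P)] (p : V → Plane) :
    Matrix G.edgeSet ({v : V // v ∉ P} × Fin 2) ℝ :=
  fun e vi =>
    if h : (vi.1 : V) ∈ (e : Sym2 V) then (p vi.1 - p (Sym2.Mem.other h)) vi.2 else 0

/-- The pinned framework `(G, p, P)` is isostatic: `|E| = 2|F|` where `F = V \ P`
is the set of free vertices, and the (square) pinned rigidity matrix is nonsingular,
i.e. has full rank. -/
def PinnedIsostatic {V : Type*} [Fintype V] [DecidableEq V] (G : SimpleGraph V)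
    [DecidableRel G.Adj] (P : Set V) [DecidablePred (· ∈ P)] (p : V → Plane) : Prop :=
  Fintype.card G.edgeSet = 2 * Fintype.card {v : V // v ∉ P} ∧
  (pinnedRigidityMatrix G P p).rank = 2 * Fintype.card {v : V // v ∉ P}


open Set Filter Topology Matrix

/-- The values of a derivation on an algebraically independent family are arbitrary. -/
theorem exists_derivation_of_algebraicIndependent {k L : Type*} [Field k] [CharZero k] [Field L]
    [Algebra k L] {ι : Type*} {x : ι → L} (hx : AlgebraicIndependent k x) (a : ι → L) :
    ∃ D : Derivation k L L, ∀ i, D (x i) = a i := by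
  classical
  obtain ⟨s, hs, hsb⟩ := exists_isTranscendenceBasis_superset (R := k) hx.to_subtype_range
  let S := MvPolynomial s k
  let : Algebra S L := (MvPolynomial.aeval (Subtype.val : s → L)).toAlgebra
  have halg : ∀ p : S, algebraMap S L p = MvPolynomial.aeval (Subtype.val : s → L) p := fun _ => rfl
  have : IsScalarTower k S L := IsScalarTower.of_algebraMap_eq' (by
    ext r; simp [RingHom.algebraMap_toAlgebra])
  have hinj : Function.Injective (algebraMap S L) := hsb.1
  have : FaithfulSMul S L := (faithfulSMul_iff_algebraMap_injective S L).2 hinj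
  have : Algebra.IsAlgebraic S L := by
    have := hsb.isAlgebraic
    refine (Algebra.isAlgebraic_ringHom_iff_of_comp_eq (hsb.1.aevalEquiv) (RingEquiv.refl L) ?_).1 this
    exact RingHom.ext fun q => hsb.1.algebraMap_aevalEquiv q
  let : Algebra (FractionRing S) L := FractionRing.liftAlgebra S L
  have : IsScalarTower S (FractionRing S) L := FractionRing.isScalarTower_liftAlgebra S L
  have : Algebra.IsAlgebraic (FractionRing S) L :=
    (IsFractionRing.comap_isAlgebraic_iff (A := S) (K := FractionRing S) (C := L)).1 inferInstance
  have : CharZero (FractionRing S) := charZero_of_injective_algebraMap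
    (FaithfulSMul.algebraMap_injective k (FractionRing S))
  have : Algebra.FormallyEtale S (FractionRing S) := .of_isLocalization (nonZeroDivisors S)
  have : Algebra.FormallyEtale (FractionRing S) L := Algebra.FormallyEtale.of_isSeparable _ _
  have : Algebra.FormallyEtale S L := .comp S (FractionRing S) L
  let b : s → L := fun y => if h : (y : L) ∈ range x then a h.choose else 0
  let D₀ : Derivation k S L := MvPolynomial.mkDerivation k b
  have hbc := KaehlerDifferential.isBaseChange_of_formallyEtale k S L
  refine ⟨(hbc.lift D₀.liftKaehlerDifferential).compDer (KaehlerDifferential.D k L), fun i => ?_⟩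
  have hi : x i ∈ range x := ⟨i, rfl⟩
  have hX : x i = algebraMap S L (MvPolynomial.X ⟨x i, hs hi⟩) := by simp [halg]
  have hval : (hbc.lift D₀.liftKaehlerDifferential) (KaehlerDifferential.D k L (x i)) = a i := by
    rw [hX, ← KaehlerDifferential.map_D k k S L, hbc.lift_eq,
      Derivation.liftKaehlerDifferential_comp_D]
    exact (MvPolynomial.mkDerivation_X k b ⟨x i, hs hi⟩).trans
      ((dif_pos hi).trans (congrArg a (hx.injective hi.choose_spec)))
  exact hval

theorem exists_integralCurve_of_lipschitz {E : Type*} [NormedAddCommGroup E] [NormedSpace ℝ E]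
    [CompleteSpace E] {X : E → E} {K L : NNReal} (hX : LipschitzWith K X) (hL : ∀ x, ‖X x‖ ≤ L)
    (x : E) : ∃ γ : ℝ → E, γ 0 = x ∧ ∀ t, HasDerivAt γ (X (γ t)) t := by
  have hloc : ∀ n : ℕ, ∃ α : ℝ → E, α 0 = x ∧
      ∀ t ∈ Ioo (-(n : ℝ)) n, HasDerivAt α (X (α t)) t := by
    intro n
    have hn : (0 : ℝ) ≤ n := n.cast_nonneg
    have h0 : (0 : ℝ) ∈ Icc (-(n : ℝ)) n := ⟨by linarith, hn⟩
    have hPL : IsPicardLindelof (fun _ => X) (⟨0, h0⟩ : Icc (-(n : ℝ)) n) x (L * n) 0 L K :=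
      { lipschitzOnWith := fun _ _ => hX.lipschitzOnWith
        continuousOn := fun _ _ => continuousOn_const
        norm_le := fun _ _ y _ => hL y
        mul_max_le := by simp }
    obtain ⟨α, hα0, hα⟩ := hPL.exists_eq_forall_mem_Icc_hasDerivWithinAt₀
    exact ⟨α, hα0, fun t ht =>
      (hα t (Ioo_subset_Icc_self ht)).hasDerivAt (Icc_mem_nhds ht.1 ht.2)⟩
  choose α hα0 hα using hloc
  have hagree : ∀ m n : ℕ, m ≤ n → EqOn (α m) (α n) (Ioo (-(m : ℝ)) m) := by
    intro m n hmn t ht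
    have hm : (0 : ℝ) < m := by have := ht.1.trans ht.2; linarith
    have hmn' : (m : ℝ) ≤ n := by exact_mod_cast hmn
    refine ODE_solution_unique_of_mem_Ioo (v := fun _ => X) (s := fun _ => univ) (t₀ := 0)
      (fun _ _ => hX.lipschitzOnWith) ⟨by linarith, hm⟩
      (fun t ht => ⟨hα m t ht, trivial⟩)
      (fun t ht => ⟨hα n t ⟨by linarith [ht.1], by linarith [ht.2]⟩, trivial⟩) ?_ ht
    rw [hα0, hα0]
  have hmem : ∀ t : ℝ, ∀ n : ℕ, |t| < n → t ∈ Ioo (-(n : ℝ)) n := fun t n h => abs_lt.mp h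
  refine ⟨fun t => α (⌊|t|⌋₊ + 1) t, hα0 _, fun t => ?_⟩
  obtain ⟨n, hn⟩ := exists_nat_gt (|t| + 1)
  have hev : (fun s => α (⌊|s|⌋₊ + 1) s) =ᶠ[𝓝 t] α n := by
    filter_upwards [(continuous_abs.tendsto t).eventually_lt_const (lt_add_one |t|)] with s hs
    refine hagree _ _ ?_ (hmem s _ ?_)
    · have : (⌊|s|⌋₊ : ℝ) < n := (Nat.floor_le (abs_nonneg s)).trans_lt (hs.trans hn)
      exact_mod_cast this
    · push_cast; exact Nat.lt_floor_add_one _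
  have := (hα n t (hmem t n (by linarith))).congr_of_eventuallyEq hev
  rwa [← hev.self_of_nhds] at this

theorem HasCompactSupport.exists_integralCurve {E : Type*} [NormedAddCommGroup E] [NormedSpace ℝ E]
    [CompleteSpace E] {X : E → E} (hX : ContDiff ℝ 1 X) (hs : HasCompactSupport X) (x : E) :
    ∃ γ : ℝ → E, γ 0 = x ∧ ∀ t, HasDerivAt γ (X (γ t)) t := by
  obtain ⟨K, hK⟩ := hX.lipschitzWith_of_hasCompactSupport hs one_ne_zero
  obtain ⟨L, hL⟩ := hs.exists_bound_of_continuous hX.continuous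
  exact exists_integralCurve_of_lipschitz hK (L := L.toNNReal)
    (fun y => (hL y).trans (Real.le_coe_toNNReal L)) x

/-- Integral curves of an autonomous Lipschitz vector field through a common point differ by a
translation of time. -/
theorem integralCurve_shift_eq {E : Type*} [NormedAddCommGroup E] [NormedSpace ℝ E]
    {X : E → E} {K : NNReal} (hX : LipschitzWith K X) {α β : ℝ → E}
    (hα : ∀ t, HasDerivAt α (X (α t)) t) (hβ : ∀ t, HasDerivAt β (X (β t)) t) {a b : ℝ}
    (hab : α a = β b) (t : ℝ) : α (t + a) = β (t + b) := by
  have := ODE_solution_unique_univ (v := fun _ => X) (s := fun _ => univ) (t₀ := 0)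
    (f := fun t => α (t + a)) (g := fun t => β (t + b)) (fun _ => hX.lipschitzOnWith)
    (fun t => ⟨(hα (t + a)).comp_add_const t a, trivial⟩)
    (fun t => ⟨(hβ (t + b)).comp_add_const t b, trivial⟩) (by simpa using hab)
  exact congrFun this t

/-- A function whose derivative along a closed curve is nonzero at time zero takes its initial value
at a second point of the curve. -/
theorem exists_mem_eq_ne_of_periodic {α : Type*} [TopologicalSpace α] [T1Space α] {γ : ℝ → α}
    (hγ : Continuous γ) (hper : ∀ t, γ t = γ 0 → Function.Periodic γ t) {T : ℝ} (hT : 0 < T)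
    (hγT : γ T = γ 0) {h : α → ℝ}
    (hh : Continuous h) {d : ℝ} (hd : HasDerivAt (h ∘ γ) d 0) (hd0 : d ≠ 0) :
    ∃ s, h (γ s) = h (γ 0) ∧ γ s ≠ γ 0 := by
  wlog hpos : 0 < d generalizing h d
  · have := this (h := fun x => -h x) (by fun_prop) (d := -d) hd.neg (neg_ne_zero.2 hd0)
      (by have := lt_of_le_of_ne (not_lt.1 hpos) hd0; linarith)
    simpa using this
  obtain ⟨δ, hδ, hlt⟩ : ∃ δ > 0, ∀ t : ℝ, |t| < δ →
      (0 < t → h (γ 0) < h (γ t)) ∧ (t < 0 → h (γ t) < h (γ 0)) := by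
    have hslope := (hasDerivAt_iff_tendsto_slope_zero.1 hd).eventually_const_lt hpos
    rw [eventually_nhdsWithin_iff, Metric.eventually_nhds_iff] at hslope
    obtain ⟨δ, hδ, H⟩ := hslope
    refine ⟨δ, hδ, fun t ht => ⟨fun h0 => ?_, fun h0 => ?_⟩⟩
    · have := H (y := t) (by simpa using ht) h0.ne'
      simp only [zero_add, smul_eq_mul, Function.comp] at this
      have := (pos_iff_pos_of_mul_pos this).1 (by positivity)
      linarith
    · have := H (y := t) (by simpa using ht) h0.ne
      simp only [zero_add, smul_eq_mul, Function.comp] at this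
      have := (neg_iff_neg_of_mul_pos this).1 (inv_lt_zero.2 h0)
      linarith
  have hTδ : ∀ t, 0 < t → γ t = γ 0 → δ ≤ t := by
    intro t ht h0
    by_contra! hlt'
    have := (hlt t (by rwa [abs_of_pos ht])).1 ht
    rw [h0] at this
    exact lt_irrefl _ this
  let S : Set ℝ := {t | δ ≤ t ∧ γ t = γ 0}
  have hS : IsClosed S := isClosed_Ici.inter (isClosed_singleton.preimage hγ)
  have hSne : S.Nonempty := ⟨T, hTδ T hT hγT, hγT⟩
  have hSb : BddBelow S := ⟨δ, fun t ht => ht.1⟩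
  obtain ⟨hT1, hT0⟩ := hS.csInf_mem hSne hSb
  set T₀ := sInf S
  have hback : h (γ (T₀ - δ / 3)) < h (γ 0) := by
    have : γ (T₀ - δ / 3) = γ (-(δ / 3)) := by
      rw [← hper T₀ hT0 (-(δ / 3)), neg_add_eq_sub]
    rw [this]
    exact (hlt _ (by rw [abs_neg, abs_of_pos (by positivity)]; linarith)).2 (by linarith)
  have hfwd : h (γ 0) < h (γ (δ / 3)) :=
    (hlt _ (by rw [abs_of_pos (by positivity)]; linarith)).1 (by positivity)
  obtain ⟨s, hs, hs0⟩ := intermediate_value_Icc' (f := fun t => h (γ t))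
    (a := δ / 3) (b := T₀ - δ / 3) (by linarith) (by fun_prop) ⟨hback.le, hfwd.le⟩
  refine ⟨s, hs0, fun hsp => ?_⟩
  have := csInf_le hSb (show s ∈ S from ⟨hTδ s (by linarith [hs.1]) hsp, hsp⟩)
  linarith [hs.2]

open Metric in
/-- If the common level set of the functions `f i` through `p` is bounded and locally a curve
parametrized by a linear form, and the vector field `X` is tangent to it, then the
integral curve of `X` through `p` meets the level set of `h` through `p` in a second point. -/
theorem exists_second_point_of_compact_level_curve {E κ : Type*} [NormedAddCommGroup E]
    [NormedSpace ℝ E] [FiniteDimensional ℝ E] {f : κ → E → ℝ} {X : E → E} {h : E → ℝ} {p : E}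
    (hX : ContDiff ℝ 1 X) (hf : ∀ i, Differentiable ℝ (f i))
    (hfX : ∀ i x, fderiv ℝ (f i) x (X x) = 0)
    (hC : Bornology.IsBounded {x | ∀ i, f i x = f i p})
    (hinj : ∀ z, (∀ i, f i z = f i p) → ∃ ℓ : E →L[ℝ] ℝ, ℓ (X z) ≠ 0 ∧ ∃ U ∈ 𝓝 z,
      ∀ x ∈ U, ∀ y ∈ U, (∀ i, f i x = f i y) → ℓ x = ℓ y → x = y)
    (hh : Differentiable ℝ h) (hhX : fderiv ℝ h p (X p) ≠ 0) :
    ∃ γ : ℝ → E, Continuous γ ∧ γ 0 = p ∧ (∀ t i, f i (γ t) = f i p) ∧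
      ∃ s, h (γ s) = h p ∧ γ s ≠ p := by
  set C : Set E := {x | ∀ i, f i x = f i p} with hCdef
  have hCc : IsClosed C := by
    simp only [hCdef, ofPred_forall]
    exact isClosed_iInter fun i => isClosed_eq (hf i).continuous continuous_const
  have hCcpt : IsCompact C := isCompact_of_isClosed_isBounded hCc hC
  obtain ⟨R, hR⟩ := hC.subset_closedBall 0
  let χ : ContDiffBump (0 : E) := ⟨|R| + 1, |R| + 2, by positivity, by linarith⟩
  let Y : E → E := fun x => χ x • X x
  have hY : ContDiff ℝ 1 Y := χ.contDiff.smul hX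
  have hYs : HasCompactSupport Y := χ.hasCompactSupport.smul_right
  have hYC : ∀ x ∈ C, Y x = X x := by
    intro x hx
    have : χ x = 1 := χ.one_of_mem_closedBall
      (closedBall_subset_closedBall (by have := le_abs_self R; simp [χ]; linarith) (hR hx))
    simp [Y, this]
  obtain ⟨K, hK⟩ := hY.lipschitzWith_of_hasCompactSupport hYs one_ne_zero
  have hstay : ∀ γ : ℝ → E, (∀ t, HasDerivAt γ (Y (γ t)) t) → ∀ s t i, f i (γ s) = f i (γ t) := by
    intro γ hγ s t i
    have hd : ∀ t, HasDerivAt (f i ∘ γ) 0 t := fun t => by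
      have := ((hf i) (γ t)).hasFDerivAt.comp_hasDerivAt t (hγ t)
      simpa [Y, hfX] using this
    exact is_const_of_deriv_eq_zero (fun t => (hd t).differentiableAt) (fun t => (hd t).deriv) s t
  -- every point of `C` near `z` lies on a short arc of the integral curve through `z`
  have harc : ∀ z ∈ C, ∀ β : ℝ → E, β 0 = z → (∀ t, HasDerivAt β (Y (β t)) t) →
      ∀ᶠ y in 𝓝 z, y ∈ C → ∃ τ, |τ| < 1 / 3 ∧ β τ = y := by
    rintro z hz β rfl hβ
    obtain ⟨ℓ, hℓ, U, hU, hUinj⟩ := hinj _ hz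
    have hβc : Continuous β := continuous_iff_continuousAt.2 fun t => (hβ t).continuousAt
    have hd : ∀ t, HasDerivAt (fun t => ℓ (β t)) (ℓ (Y (β t))) t := fun t =>
      ℓ.hasFDerivAt.comp_hasDerivAt t (hβ t)
    have hstrict : HasStrictDerivAt (fun t => ℓ (β t)) (ℓ (Y (β 0))) 0 :=
      hasStrictDerivAt_of_hasDerivAt_of_continuousAt (Eventually.of_forall hd)
        (ℓ.continuous.comp (hY.continuous.comp hβc)).continuousAt
    have hmap := hstrict.map_nhds_eq (by rwa [hYC _ hz])
    have hN : β ⁻¹' U ∩ ball 0 (1 / 3) ∈ 𝓝 (0 : ℝ) :=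
      inter_mem (hβc.continuousAt hU) (ball_mem_nhds _ (by norm_num))
    have himg := image_mem_map (m := fun t => ℓ (β t)) hN
    rw [hmap] at himg
    filter_upwards [hU, ℓ.continuous.continuousAt himg] with y hyU hy hyC
    obtain ⟨τ, ⟨hτU, hτ⟩, hτy⟩ := hy
    refine ⟨τ, by simpa using hτ, hUinj _ hτU _ hyU (fun i => ?_) hτy⟩
    rw [hstay β hβ τ 0 i, hz i, hyC i]
  obtain ⟨γ, hγ0, hγ⟩ := hYs.exists_integralCurve hY p
  have hγc : Continuous γ := continuous_iff_continuousAt.2 fun t => (hγ t).continuousAt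
  have hγC : ∀ t, γ t ∈ C := fun t i => by rw [hstay γ hγ t 0 i, hγ0]
  have hret : ∀ a b, γ a = γ b → Function.Periodic γ (b - a) := fun a b hab t => by
    have := integralCurve_shift_eq hK hγ hγ hab (t - a)
    rw [show t + (b - a) = t - a + b by ring, ← this, sub_add_cancel]
  obtain ⟨T, hT, hγT⟩ : ∃ T, 0 < T ∧ γ T = γ 0 := by
    obtain ⟨z, hz, φ, hφ, hlim⟩ := hCcpt.tendsto_subseq (fun n : ℕ => hγC n)
    obtain ⟨β, hβ0, hβ⟩ := hYs.exists_integralCurve hY z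
    obtain ⟨N, hN⟩ := eventually_atTop.1 (hlim.eventually (harc z hz β hβ0 hβ))
    obtain ⟨τ, hτ, hτ'⟩ := hN N le_rfl (hγC _)
    obtain ⟨σ, hσ, hσ'⟩ := hN (N + 1) N.le_succ (hγC _)
    have hφN : ((φ N : ℕ) : ℝ) + 1 ≤ φ (N + 1) := by exact_mod_cast hφ N.lt_succ_self
    have h1 := integralCurve_shift_eq hK hγ hβ hτ'.symm (-τ)
    have h2 := integralCurve_shift_eq hK hγ hβ hσ'.symm (-σ)
    simp only [neg_add_cancel] at h1 h2
    refine ⟨-σ + φ (N + 1) - (-τ + φ N), ?_, ?_⟩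
    · have := abs_lt.1 hτ; have := abs_lt.1 hσ; linarith
    · simpa using hret _ _ (h1.trans h2.symm) 0
  have hpC : p ∈ C := fun _ => rfl
  have hd : HasDerivAt (h ∘ γ) (fderiv ℝ h p (X p)) 0 := by
    have := (hh (γ 0)).hasFDerivAt.comp_hasDerivAt 0 (hγ 0)
    rwa [hγ0, hYC p hpC] at this
  obtain ⟨s, hs, hsp⟩ := exists_mem_eq_ne_of_periodic hγc
    (fun t ht => by simpa using hret 0 t ht.symm) hT hγT hh.continuous hd hhX
  rw [hγ0] at hs hsp
  exact ⟨γ, hγc, hγ0, hγC, s, hs, hsp⟩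

/-- The configuration that agrees with `p` on the pinned vertices and whose free coordinates are
`x`. -/
def extendConfig {V : Type*} (P : Set V) [DecidablePred (· ∈ P)] (p : V → Plane)
    (x : {v : V // v ∉ P} × Fin 2 → ℝ) : V → Plane :=
  fun v => if h : v ∈ P then p v else WithLp.toLp 2 fun k => x (⟨v, h⟩, k)

/-- The squared length of an edge in a configuration. -/
def edgeSq {V : Type*} (q : V → Plane) : Sym2 V → ℝ :=
  Sym2.lift ⟨fun a b => ∑ k, (q a k - q b k) ^ 2, fun a b =>
    Finset.sum_congr rfl fun k _ => by ring⟩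

section
variable {V : Type*} (P : Set V) [DecidablePred (· ∈ P)] (p : V → Plane)
  (x : {v : V // v ∉ P} × Fin 2 → ℝ)

theorem extendConfig_of_mem {v : V} (h : v ∈ P) : extendConfig P p x v = p v := dif_pos h

theorem extendConfig_of_notMem {v : V} (h : v ∉ P) (k : Fin 2) :
    extendConfig P p x v k = x (⟨v, h⟩, k) := by simp [extendConfig, h]

theorem contDiff_extendConfig_apply {m : WithTop ℕ∞} [Fintype V] (v : V) (k : Fin 2) :
    ContDiff ℝ m fun x => extendConfig P p x v k := by
  by_cases h : v ∈ P
  · simp only [extendConfig_of_mem P p _ h]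
    exact contDiff_const
  · simp only [extendConfig_of_notMem P p _ h]
    exact contDiff_apply ..

theorem extendConfig_restrict : extendConfig P p (fun i => p i.1 i.2) = p := by
  ext v k
  by_cases h : v ∈ P
  · rw [extendConfig_of_mem P p _ h]
  · rw [extendConfig_of_notMem P p _ h]

theorem extendConfig_injective : Function.Injective (extendConfig P p) := by
  rintro x y hxy
  ext ⟨⟨v, h⟩, k⟩
  rw [← extendConfig_of_notMem P p x h, ← extendConfig_of_notMem P p y h, hxy]

theorem edgeSq_mk (q : V → Plane) (a b : V) : edgeSq q s(a, b) = ∑ k, (q a k - q b k) ^ 2 := rfl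

theorem edgeSq_eq_edgeSq_iff {q q' : V → Plane} {a b : V} :
    edgeSq q s(a, b) = edgeSq q' s(a, b) ↔ dist (q a) (q b) = dist (q' a) (q' b) := by
  have h : ∀ q : V → Plane, edgeSq q s(a, b) = dist (q a) (q b) ^ 2 := fun q => by
    rw [EuclideanSpace.dist_eq, Real.sq_sqrt (Finset.sum_nonneg fun _ _ => sq_nonneg _), edgeSq_mk]
    simp [Real.dist_eq]
  rw [h, h]
  exact sq_eq_sq₀ dist_nonneg dist_nonneg

end

theorem pinnedRigidityMatrix_mulVec {V : Type*} [Fintype V] [DecidableEq V] (G : SimpleGraph V)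
    (P : Set V) [DecidablePred (· ∈ P)] (q : V → Plane) (w : {v : V // v ∉ P} × Fin 2 → ℝ)
    {a b : V} (hab : s(a, b) ∈ G.edgeSet) :
    (pinnedRigidityMatrix G P q *ᵥ w) ⟨s(a, b), hab⟩ =
      ∑ k, (q a k - q b k) * (extendConfig P 0 w a k - extendConfig P 0 w b k) := by
  have hne : a ≠ b := G.ne_of_adj hab
  have hsum : ∀ (c : V) (k : Fin 2), ∑ v : {v : V // v ∉ P}, (if (v : V) = c then w (v, k) else 0)
      = extendConfig P 0 w c k := by
    intro c k
    by_cases hc : c ∈ P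
    · rw [extendConfig_of_mem P _ _ hc]
      exact Finset.sum_eq_zero fun v _ => if_neg fun h : (v : V) = c => v.2 (h ▸ hc)
    · rw [extendConfig_of_notMem P _ _ hc, Finset.sum_eq_single ⟨c, hc⟩]
      · simp
      · exact fun v _ hv => if_neg fun h => hv (Subtype.ext h)
      · simp
  have hentry : ∀ (v : {v : V // v ∉ P}) (k : Fin 2),
      pinnedRigidityMatrix G P q ⟨s(a, b), hab⟩ (v, k) * w (v, k) =
        (q a k - q b k) * ((if (v : V) = a then w (v, k) else 0) -
          (if (v : V) = b then w (v, k) else 0)) := by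
    intro v k
    unfold pinnedRigidityMatrix
    by_cases h : (v : V) ∈ s(a, b)
    · have hspec := Sym2.other_spec h
      rw [dif_pos h]
      generalize Sym2.Mem.other h = o at hspec ⊢
      rcases Sym2.eq_iff.1 hspec with ⟨h1, rfl⟩ | ⟨h1, rfl⟩
      · simp [h1, hne]
      · simp [h1, hne.symm]; ring
    · rw [dif_neg h]
      simp only [Sym2.mem_iff, not_or] at h
      simp [h.1, h.2]
  simp only [mulVec, dotProduct, Fintype.sum_prod_type]
  rw [Finset.sum_comm]
  refine Finset.sum_congr rfl fun k _ => ?_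
  simp only [hentry, ← Finset.mul_sum, Finset.sum_sub_distrib, hsum]

theorem hasStrictFDerivAt_edgeSq_extendConfig {V : Type*} [Fintype V] [DecidableEq V]
    (G : SimpleGraph V) (P : Set V) [DecidablePred (· ∈ P)] (p : V → Plane) (e : G.edgeSet)
    (x : {v : V // v ∉ P} × Fin 2 → ℝ) :
    HasStrictFDerivAt (fun x => edgeSq (extendConfig P p x) e)
      ((2 : ℝ) • (LinearMap.proj e ∘ₗ
        (pinnedRigidityMatrix G P (extendConfig P p x)).mulVecLin).toContinuousLinearMap) x := by
  obtain ⟨e, he⟩ := e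
  induction e using Sym2.ind with
  | _ a b =>
  have hcoord : ∀ (v : V) (k : Fin 2), ∃ L : ({v : V // v ∉ P} × Fin 2 → ℝ) →L[ℝ] ℝ,
      (∀ w, L w = extendConfig P 0 w v k) ∧
      HasStrictFDerivAt (fun x => extendConfig P p x v k) L x := by
    intro v k
    by_cases hv : v ∈ P
    · refine ⟨0, fun w => ?_, ?_⟩
      · rw [extendConfig_of_mem P _ _ hv]; rfl
      · simp only [extendConfig_of_mem P _ _ hv]; exact hasStrictFDerivAt_const _ _
    · refine ⟨ContinuousLinearMap.proj (⟨v, hv⟩, k), fun w => ?_, ?_⟩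
      · rw [extendConfig_of_notMem P _ _ hv]; rfl
      · simp only [extendConfig_of_notMem P _ _ hv]; exact hasStrictFDerivAt_apply _ _
  choose L hL hLd using hcoord
  have := HasStrictFDerivAt.fun_sum (u := Finset.univ) fun k _ =>
    ((hLd a k).sub (hLd b k)).pow 2
  refine this.congr_fderiv ?_
  ext1 w
  simp [pinnedRigidityMatrix_mulVec, hL]
  ring

/-- At a configuration realizing given lengths of a generic framework, every instantaneous change of
those lengths that can be achieved at the generic framework can be achieved as well. -/
theorem exists_mulVec_eq_of_isGenericConfig {V : Type*} [Fintype V] [DecidableEq V]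
    (G : SimpleGraph V) (P : Set V) [DecidablePred (· ∈ P)] {p z : V → Plane}
    (hgen : IsGenericConfig 2 p) (hz : ∀ v ∈ P, z v = p v)
    (a : {v : V // v ∉ P} × Fin 2 → ℝ) :
    ∃ w, ∀ e : G.edgeSet, edgeSq z e = edgeSq p e →
      (pinnedRigidityMatrix G P z *ᵥ w) e = (pinnedRigidityMatrix G P p *ᵥ a) e := by
  obtain ⟨D, hD⟩ := exists_derivation_of_algebraicIndependent hgen
    fun vi => extendConfig P 0 a vi.1 vi.2
  have hw : ∀ v k, extendConfig P 0 (fun vi => D (z vi.1 vi.2)) v k = D (z v k) := by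
    intro v k
    by_cases hv : v ∈ P
    · have := hD (v, k)
      simp only [extendConfig_of_mem P _ _ hv] at this
      rw [extendConfig_of_mem P _ _ hv, hz v hv, this]
    · rw [extendConfig_of_notMem P _ _ hv]
  refine ⟨fun vi => D (z vi.1 vi.2), fun ⟨e, he⟩ hlen => ?_⟩
  induction e using Sym2.ind with
  | _ u v =>
  have hDlen : ∀ q : V → Plane, D (edgeSq q s(u, v)) =
      2 * ∑ k, (q u k - q v k) * (D (q u k) - D (q v k)) := by
    intro q
    rw [edgeSq_mk, map_sum, Finset.mul_sum]
    refine Finset.sum_congr rfl fun k _ => ?_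
    rw [Derivation.leibniz_pow, map_sub]
    simp
  have h := congrArg D hlen
  rw [hDlen, hDlen] at h
  rw [pinnedRigidityMatrix_mulVec, pinnedRigidityMatrix_mulVec]
  simp only [hw]
  have hDp : ∀ v k, D (p v k) = extendConfig P 0 a v k := fun v k => hD (v, k)
  simp only [hDp] at h
  linarith

theorem exists_ne_zero_sum_mul_eq_zero (δ : Fin 2 → ℝ) :
    ∃ d : Fin 2 → ℝ, d ≠ 0 ∧ ∑ k, δ k * d k = 0 := by
  by_cases h : δ = 0
  · exact ⟨fun _ => 1, fun h1 => one_ne_zero (congrFun h1 0), by simp [h]⟩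
  · refine ⟨![-δ 1, δ 0], fun hd => h ?_, by simp [Fin.sum_univ_two]; ring⟩
    have h0 := congrFun hd 0
    have h1 := congrFun hd 1
    ext k
    fin_cases k
    · simpa using h1
    · simpa using h0

/-- If the pinned rigidity matrix has trivial kernel, then removing one edge leaves a linkage with
bounded configuration space. -/
theorem isBounded_setOf_edgeSq_eq {V : Type*} [Fintype V] [DecidableEq V]
    (G : SimpleGraph V) (P : Set V) [DecidablePred (· ∈ P)] {p : V → Plane}
    (hker : ∀ w, pinnedRigidityMatrix G P p *ᵥ w = 0 → w = 0) (e : G.edgeSet) :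
    Bornology.IsBounded {x | ∀ i : {i : G.edgeSet // i ≠ e},
      edgeSq (extendConfig P p x) i = edgeSq p i} := by
  classical
  set C := {x | ∀ i : {i : G.edgeSet // i ≠ e}, edgeSq (extendConfig P p x) i = edgeSq p i}
  let W : Set V := {v | ∃ B, ∀ x ∈ C, ∀ k, |extendConfig P p x v k| ≤ B}
  have hPW : ∀ v ∈ P, v ∈ W := fun v hv =>
    ⟨∑ k, |p v k|, fun x _ k => by
      rw [extendConfig_of_mem P p x hv]
      exact Finset.single_le_sum (f := fun k => |p v k|) (fun _ _ => abs_nonneg _)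
        (Finset.mem_univ k)⟩
  have hadj : ∀ u v (h : s(u, v) ∈ G.edgeSet), ⟨s(u, v), h⟩ ≠ e → u ∈ W → v ∈ W := by
    rintro u v h he ⟨B, hB⟩
    refine ⟨B + √(edgeSq p s(u, v)), fun x hx k => ?_⟩
    have hlen : edgeSq (extendConfig P p x) s(u, v) = edgeSq p s(u, v) := hx ⟨⟨s(u, v), h⟩, he⟩
    have hk : |extendConfig P p x u k - extendConfig P p x v k| ≤ √(edgeSq p s(u, v)) := by
      refine Real.abs_le_sqrt ?_
      rw [← hlen, edgeSq_mk]
      exact Finset.single_le_sum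
        (f := fun k => (extendConfig P p x u k - extendConfig P p x v k) ^ 2)
        (fun _ _ => sq_nonneg _) (Finset.mem_univ k)
    have := hB x hx k
    rw [abs_le] at *
    constructor <;> linarith
  obtain ⟨⟨e, he⟩, rfl⟩ : ∃ e', e' = e := ⟨e, rfl⟩
  induction e using Sym2.ind with
  | _ a b =>
  have hW : ∀ v, v ∈ W := by
    obtain ⟨d, hd, hd0⟩ := exists_ne_zero_sum_mul_eq_zero fun k => p a k - p b k
    let t : {v : V // v ∉ P} × Fin 2 → ℝ := fun vi => if (vi.1 : V) ∈ W then 0 else d vi.2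
    have ht : ∀ v k, extendConfig P 0 t v k = if v ∈ W then 0 else d k := by
      intro v k
      by_cases hv : v ∈ P
      · rw [extendConfig_of_mem P _ _ hv, if_pos (hPW v hv)]; rfl
      · rw [extendConfig_of_notMem P _ _ hv]
    have ht0 : t = 0 := by
      refine hker t (funext fun ⟨i, hi⟩ => ?_)
      induction i using Sym2.ind with
      | _ u v =>
      rw [pinnedRigidityMatrix_mulVec]
      simp only [ht]
      by_cases hie : s(u, v) = s(a, b)
      · have hd' : ∑ k, (p u k - p v k) * d k = 0 := by
          rcases Sym2.eq_iff.1 hie with ⟨rfl, rfl⟩ | ⟨rfl, rfl⟩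
          · exact hd0
          · rw [← neg_eq_zero, ← hd0, ← Finset.sum_neg_distrib]
            exact Finset.sum_congr rfl fun k _ => by ring
        by_cases hu : u ∈ W <;> by_cases hv : v ∈ W <;> simp [hu, hv] at hd' ⊢ <;> linarith
      · have huv : u ∈ W ↔ v ∈ W := by
          have hi' : s(v, u) ∈ G.edgeSet := by rwa [Sym2.eq_swap]
          refine ⟨hadj u v hi fun h => hie (congrArg Subtype.val h), hadj v u hi' fun h => hie ?_⟩
          rw [Sym2.eq_swap]
          exact congrArg Subtype.val h
        simp [huv]
    intro v
    by_contra hv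
    refine hd (funext fun k => ?_)
    have := congrFun ht0 (⟨v, fun h => hv (hPW v h)⟩, k)
    simpa [t, hv] using this
  choose B hB using hW
  refine (Metric.isBounded_closedBall (x := 0) (r := ∑ v, |B v|)).subset fun x hx => ?_
  rw [mem_closedBall_zero_iff, pi_norm_le_iff_of_nonneg (Finset.sum_nonneg fun _ _ => abs_nonneg _)]
  rintro ⟨⟨v, hv⟩, k⟩
  have h := hB v x hx k
  rw [extendConfig_of_notMem P p x hv] at h
  exact (h.trans (le_abs_self _)).trans
    (Finset.single_le_sum (f := fun v => |B v|) (fun _ _ => abs_nonneg _) (Finset.mem_univ v))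

/-- If all rows of a square matrix but one are linearly independent, then the remaining row can be
replaced to make the matrix nonsingular. -/
theorem exists_det_updateRow_ne_zero {n K : Type*} [Fintype n] [DecidableEq n] [Field K]
    {M : Matrix n n K} {j : n} (hM : ∀ b : n → K, ∃ w, ∀ i ≠ j, (M *ᵥ w) i = b i) :
    ∃ r, (M.updateRow j r).det ≠ 0 := by
  choose w hw using hM
  let N : Matrix n n K := Matrix.of fun i k => if k = j then 0 else w (Pi.single k 1) i
  have hN : N.det = 0 := det_eq_zero_of_column_eq_zero j fun i => by simp [N]
  obtain ⟨r, hr, hrN⟩ := exists_vecMul_eq_zero_iff.2 hN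
  refine ⟨r, fun hdet => ?_⟩
  obtain ⟨c, hc, hcM⟩ := exists_vecMul_eq_zero_iff.2 hdet
  have hprod : ∀ i k, k ≠ j → (M.updateRow j r * N) i k = if i = k then 1 else 0 := by
    intro i k hk
    by_cases hi : i = j
    · subst hi
      have := congrFun hrN k
      simp only [Matrix.mul_apply, updateRow_self]
      rw [if_neg hk.symm]
      exact this
    · have := hw (Pi.single k 1) i hi
      rw [Pi.single_apply] at this
      rw [← this]
      simp [Matrix.mul_apply, updateRow_ne hi, N, hk, mulVec, dotProduct]
  have hck : ∀ k ≠ j, c k = 0 := by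
    intro k hk
    have h := congrFun (congrArg (· ᵥ* N) hcM) k
    simp only [vecMul_vecMul, zero_vecMul] at h
    simpa [vecMul, dotProduct, hprod _ k hk] using h
  have hcj : c j = 0 := by
    obtain ⟨k, hk⟩ := Function.ne_iff.1 hr
    have h := congrFun hcM k
    rw [vecMul, dotProduct, Finset.sum_eq_single j (fun i _ hi => by simp [hck i hi])
      (by simp)] at h
    simpa [show r k ≠ 0 from hk] using h
  refine hc (funext fun k => ?_)
  by_cases hk : k = j
  · rw [hk, hcj]; rfl
  · exact hck k hk

theorem dotProduct_adjugate_col {n R : Type*} [Fintype n] [DecidableEq n] [CommRing R]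
    (M : Matrix n n R) (j : n) (r : n → R) :
    r ⬝ᵥ (fun i => M.adjugate i j) = (M.updateRow j r).det := by
  have h := congrFun (congrFun (mul_adjugate (M.updateRow j r)) j) j
  rw [Matrix.mul_apply] at h
  simpa [dotProduct, adjugate_apply] using h

theorem mulVec_adjugate_col {n R : Type*} [Fintype n] [DecidableEq n] [CommRing R]
    (M : Matrix n n R) (i j : n) :
    (M *ᵥ fun i => M.adjugate i j) i = if i = j then M.det else 0 := by
  have h := congrFun (congrFun (mul_adjugate M) i) j
  rw [Matrix.mul_apply] at h
  simpa [mulVec, dotProduct, Matrix.one_apply] using h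

theorem contDiff_adjugate_apply {n E : Type*} [Fintype n] [DecidableEq n] [NormedAddCommGroup E]
    [NormedSpace ℝ E] {k : WithTop ℕ∞} {M : E → Matrix n n ℝ}
    (hM : ∀ i j, ContDiff ℝ k fun x => M x i j) (i j : n) :
    ContDiff ℝ k fun x => (M x).adjugate i j := by
  simp only [adjugate_apply, det_apply]
  refine ContDiff.sum fun σ _ => ContDiff.const_smul _ (contDiff_prod fun l _ => ?_)
  by_cases h : σ l = j
  · simp only [h, updateRow_self]; exact contDiff_const
  · simp only [updateRow_ne h]; exact hM _ _

/-- If the rigidity matrix becomes nonsingular when the row of `e` is replaced by a linear form, then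
this form and the lengths of the edges other than `e` are locally injective coordinates. -/
theorem exists_nhds_injOn_edgeSq {V : Type*} [Fintype V] [DecidableEq V] (G : SimpleGraph V)
    (P : Set V) [DecidablePred (· ∈ P)] (p : V → Plane)
    (σ : G.edgeSet ≃ {v : V // v ∉ P} × Fin 2) (e : G.edgeSet)
    (z r : {v : V // v ∉ P} × Fin 2 → ℝ)
    (hr : (((pinnedRigidityMatrix G P (extendConfig P p z)).submatrix σ.symm id).updateRow
      (σ e) r).det ≠ 0) :
    ∃ U ∈ 𝓝 z, ∀ x ∈ U, ∀ y ∈ U, (∀ i : {i : G.edgeSet // i ≠ e},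
      edgeSq (extendConfig P p x) i = edgeSq (extendConfig P p y) i) →
      r ⬝ᵥ x = r ⬝ᵥ y → x = y := by
  set M := (pinnedRigidityMatrix G P (extendConfig P p z)).submatrix σ.symm id with hM
  let Φ : ({v : V // v ∉ P} × Fin 2 → ℝ) → ({v : V // v ∉ P} × Fin 2 → ℝ) := fun x i =>
    if i = σ e then r ⬝ᵥ x else (1 / 2 : ℝ) * edgeSq (extendConfig P p x) (σ.symm i)
  let A := ((M.updateRow (σ e) r).toLinearEquiv' ((M.updateRow (σ e) r).invertibleOfIsUnitDet
    hr.isUnit)).toContinuousLinearEquiv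
  have hΦ : HasStrictFDerivAt Φ (A : _ →L[ℝ] _) z := by
    rw [hasStrictFDerivAt_pi']
    intro i
    by_cases hi : i = σ e
    · subst hi
      simp only [Φ, if_true]
      refine (LinearMap.toContinuousLinearMap
        (dotProductBilin ℝ ℝ r)).hasStrictFDerivAt.congr_fderiv ?_
      ext1 w
      change r ⬝ᵥ w = (M.updateRow (σ e) r *ᵥ w) (σ e)
      simp [mulVec]
    · simp only [Φ, if_neg hi]
      refine ((hasStrictFDerivAt_edgeSq_extendConfig G P p (σ.symm i) z).const_mul
        (1 / 2 : ℝ)).congr_fderiv ?_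
      ext1 w
      change (1 / 2 : ℝ) * (2 * (pinnedRigidityMatrix G P (extendConfig P p z) *ᵥ w) (σ.symm i)) =
        (M.updateRow (σ e) r *ᵥ w) i
      have hrow : (M.updateRow (σ e) r *ᵥ w) i =
          (pinnedRigidityMatrix G P (extendConfig P p z) *ᵥ w) (σ.symm i) := by
        simp only [mulVec, updateRow_ne hi]
        rfl
      rw [hrow]
      ring
  exact ⟨(hΦ.toOpenPartialHomeomorph Φ).source,
    (hΦ.toOpenPartialHomeomorph Φ).open_source.mem_nhds hΦ.mem_toOpenPartialHomeomorph_source,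
    fun x hx y hy hxy hℓ => (hΦ.toOpenPartialHomeomorph Φ).injOn hx hy (funext fun i => by
      simp only [HasStrictFDerivAt.toOpenPartialHomeomorph_coe, Φ]
      split_ifs with hi
      · exact hℓ
      · rw [hxy ⟨σ.symm i, fun h => hi (by rw [← h, Equiv.apply_symm_apply])⟩])⟩


/-- The guarantee underlying the single-cut algorithm: for a generic pinned isostatic
framework in the plane (with at least three pins) and any edge `{u₀, v₀}`, there is a
second equivalent realization `q ≠ p` fixing the pins and preserving all edge lengths,
joined to `p` by a continuous path of configurations along which the pins stay fixed
and the lengths of all edges other than `{u₀, v₀}` are preserved. -/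
theorem single_cut_reaches_second_realization
    {V : Type*} [Fintype V] [DecidableEq V] (G : SimpleGraph V) [DecidableRel G.Adj]
    (P : Set V) [DecidablePred (· ∈ P)] (hP : 3 ≤ P.ncard)
    (p : V → Plane) (hgen : IsGenericConfig 2 p) (hiso : PinnedIsostatic G P p)
    (u₀ v₀ : V) (he : G.Adj u₀ v₀) :
    ∃ q : V → Plane, q ≠ p ∧
      (∀ v ∈ P, q v = p v) ∧
      (∀ ⦃u w : V⦄, G.Adj u w → dist (q u) (q w) = dist (p u) (p w)) ∧
      ∃ γ : Path p q, ∀ t : unitInterval,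
        (∀ v ∈ P, γ t v = p v) ∧
        ∀ ⦃u w : V⦄, G.Adj u w → s(u, w) ≠ s(u₀, v₀) →
          dist (γ t u) (γ t w) = dist (p u) (p w) := by
  classical
  obtain ⟨hcard, hrank⟩ := hiso
  let n := {v : V // v ∉ P} × Fin 2
  have hcardn : Fintype.card n = 2 * Fintype.card {v : V // v ∉ P} := by
    simp [n, mul_comm]
  let σ : G.edgeSet ≃ n := Fintype.equivOfCardEq (hcard.trans hcardn.symm)
  let e : G.edgeSet := ⟨s(u₀, v₀), he⟩
  let M : (n → ℝ) → Matrix n n ℝ := fun x =>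
    (pinnedRigidityMatrix G P (extendConfig P p x)).submatrix σ.symm id
  let X : (n → ℝ) → n → ℝ := fun x i => (M x).adjugate i (σ e)
  let f : G.edgeSet → (n → ℝ) → ℝ := fun i x => edgeSq (extendConfig P p x) i
  let p₀ : n → ℝ := fun i => p i.1 i.2
  have hp₀ : extendConfig P p p₀ = p := extendConfig_restrict P p
  have hMmul : ∀ x w i, (M x *ᵥ w) (σ i) =
      (pinnedRigidityMatrix G P (extendConfig P p x) *ᵥ w) i := fun x w i => by
    simp only [M, mulVec, submatrix, of_apply, Equiv.symm_apply_apply, id]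
    rfl
  have hdet : (M p₀).det ≠ 0 := by
    have hr : (M p₀).rank = Fintype.card n := by
      rw [hcardn, ← hrank, ← hp₀]
      exact rank_submatrix _ σ.symm (Equiv.refl _)
    have hsurj : Function.Surjective (M p₀).mulVecLin := by
      rw [← LinearMap.range_eq_top]
      exact Submodule.eq_top_of_finrank_eq (hr.trans (Module.finrank_fintype_fun_eq_card ℝ).symm)
    intro h0
    obtain ⟨w, hw, hw0⟩ := exists_mulVec_eq_zero_iff.2 h0
    exact hw (LinearMap.injective_iff_surjective.2 hsurj (hw0.trans (mulVec_zero _).symm))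
  have hfd : ∀ i x, HasStrictFDerivAt (f i) _ x := fun i x =>
    hasStrictFDerivAt_edgeSq_extendConfig G P p i x
  have hfX : ∀ i x, fderiv ℝ (f i) x (X x) = if i = e then 2 * (M x).det else 0 := by
    intro i x
    rw [(hfd i x).hasFDerivAt.fderiv]
    have h := mulVec_adjugate_col (M x) (σ i) (σ e)
    rw [hMmul] at h
    simp only [σ.injective.eq_iff] at h
    simp [X, h]
  have hX : ContDiff ℝ 1 X := by
    refine contDiff_pi.2 fun i => contDiff_adjugate_apply (fun i j => ?_) _ _
    simp only [M, submatrix_apply, id, pinnedRigidityMatrix]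
    split_ifs with h
    · simp only [PiLp.sub_apply]
      exact (contDiff_extendConfig_apply P p _ _).sub (contDiff_extendConfig_apply P p _ _)
    · exact contDiff_const
  have hbdd : Bornology.IsBounded {x | ∀ i : {i : G.edgeSet // i ≠ e}, f i x = f i p₀} := by
    simp only [f, hp₀]
    refine isBounded_setOf_edgeSq_eq G P (fun w hw => ?_) e
    refine eq_zero_of_mulVec_eq_zero hdet (funext fun i => ?_)
    obtain ⟨i, rfl⟩ := σ.surjective i
    rw [hMmul, hp₀, hw]; rfl
  obtain ⟨γ, hγ, hγ0, hγC, s, hs, hsp⟩ := exists_second_point_of_compact_level_curve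
    (f := fun i : {i : G.edgeSet // i ≠ e} => f i) (h := f e) (p := p₀) hX
    (fun i x => (hfd i x).differentiableAt) (fun i x => by rw [hfX, if_neg i.2]) hbdd
    (fun z hz => by
      obtain ⟨r, hr⟩ : ∃ r, ((M z).updateRow (σ e) r).det ≠ 0 := by
        refine exists_det_updateRow_ne_zero fun b => ?_
        obtain ⟨w, hw⟩ := exists_mulVec_eq_of_isGenericConfig G P (z := extendConfig P p z) hgen
          (fun v hv => extendConfig_of_mem P p z hv) ((M p₀)⁻¹ *ᵥ b)
        refine ⟨w, fun i hi => ?_⟩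
        obtain ⟨i, rfl⟩ := σ.surjective i
        have hz' := hz ⟨i, fun h => hi (h ▸ rfl)⟩
        simp only [f, hp₀] at hz'
        rw [hMmul, hw i hz']
        conv_lhs => rw [← hp₀]
        rw [← hMmul, mulVec_mulVec, mul_nonsing_inv _ hdet.isUnit, one_mulVec]
      obtain ⟨U, hU, hinj⟩ := exists_nhds_injOn_edgeSq G P p σ e z r hr
      refine ⟨LinearMap.toContinuousLinearMap (dotProductBilin ℝ ℝ r), ?_, U, hU, hinj⟩
      change r ⬝ᵥ X z ≠ 0
      rwa [dotProduct_adjugate_col])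
    (fun x => (hfd e x).differentiableAt) (by rw [hfX, if_pos rfl]; simpa using hdet)
  have hdist : ∀ {x : n → ℝ} {u w : V} (h : G.Adj u w), f ⟨s(u, w), h⟩ x = f ⟨s(u, w), h⟩ p₀ →
      dist (extendConfig P p x u) (extendConfig P p x w) = dist (p u) (p w) := by
    intro x u w h hx
    simp only [f, hp₀] at hx
    exact edgeSq_eq_edgeSq_iff.1 hx
  have hext : Continuous (extendConfig P p) := by
    refine continuous_pi fun v => ?_
    by_cases hv : v ∈ P
    · simp only [extendConfig_of_mem P p _ hv]; exact continuous_const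
    · simp only [extendConfig, dif_neg hv]; fun_prop
  refine ⟨extendConfig P p (γ s), fun h => hsp ?_, fun v hv => extendConfig_of_mem P p _ hv,
    fun u w h => ?_, ⟨⟨fun t => extendConfig P p (γ (s * t)), by fun_prop⟩, ?_, ?_⟩, fun t =>
    ⟨fun v hv => extendConfig_of_mem P p _ hv, fun u w h hne => ?_⟩⟩
  · exact extendConfig_injective P p (h.trans hp₀.symm)
  · by_cases hue : (⟨s(u, w), h⟩ : G.edgeSet) = e
    · exact hdist h (by rw [hue]; exact hs)
    · exact hdist h (hγC s ⟨_, hue⟩)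
  · simp [hγ0, hp₀]
  · simp
  · exact hdist h (hγC _ ⟨⟨s(u, w), h⟩, fun h' => hne (congrArg Subtype.val h')⟩)
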